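/- Let G be a finite multigraph, t ≥ 1 an integer, and e an edge of G that is neither a loop nor a bridge. Then T_Ĝ(x,y) = (y^{t−1} + y^{t−2} + … + y + 1) · T_{\widehat{G·e}}(x,y) + T_{\widehat{G−e}}(x,y), where for a multigraph H, Ĥ denotes the multigraph obtained from H by replacing every edge by t parallel copies. -/

import Mathlib

open MvPolynomial

namespace ForestAlg

variable {V E : Type*}

/-- Two vertices are directly connected by an edge of `A`. -/
def edgeRel (ends : E → Sym2 V) (A : Finset E) (v w : V) : Prop :=
  ∃ e ∈ A, ends e = s(v, w)

/-- Number of connected components of the spanning subgraph `(V, A)`. -/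
noncomputable def numComponents (ends : E → Sym2 V) (A : Finset E) : ℕ :=
  Nat.card (Quot (edgeRel ends A))

/-- Rank `r(A) = v(G) - c(V,A)`. -/
noncomputable def rank (ends : E → Sym2 V) (A : Finset E) : ℕ :=
  Nat.card V - numComponents ends A

/-- `A` is a subforest (contains no cycle): `|A| = v(G) - c(V,A)`. -/
def IsForest (ends : E → Sym2 V) (A : Finset E) : Prop :=
  A.card + numComponents ends A = Nat.card V

/-- The Tutte polynomial, evaluated at `(x, y)`. -/
noncomputable def tutte [Fintype E] {R : Type*} [CommRing R]
    (ends : E → Sym2 V) (x y : R) : R :=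
  ∑ A ∈ (Finset.univ : Finset E).powerset,
    (x - 1) ^ (rank ends Finset.univ - rank ends A) *
      (y - 1) ^ (A.card - rank ends A)

/-- `e ∉ F` is externally active for the subforest `F` with respect to the linear
order `o`: `F + e` contains a cycle and `e` is the minimal edge of that cycle
(the edges of the unique cycle of `F + e` are those whose removal does not
decrease the rank). -/
def ExtActive [DecidableEq E] (o : LinearOrder E) (ends : E → Sym2 V)
    (F : Finset E) (e : E) : Prop :=
  e ∉ F ∧ ¬ IsForest ends (insert e F) ∧
    ∀ f ∈ insert e F,
      rank ends ((insert e F).erase f) = rank ends (insert e F) → o.le e f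

/-- External activity `act_G(F)`. -/
noncomputable def act [DecidableEq E] (o : LinearOrder E) (ends : E → Sym2 V)
    (F : Finset E) : ℕ :=
  Set.ncard {e : E | ExtActive o ends F e}

/-- `D_I`: number of edges with one endpoint in `I` and the other outside `I`. -/
noncomputable def crossCount {n : ℕ} (ends : E → Sym2 (Fin n))
    (I : Finset (Fin n)) : ℕ :=
  Set.ncard {e : E | (∃ v ∈ ends e, v ∈ I) ∧ ∃ w ∈ ends e, w ∉ I}

/-- The ideal `J_G^{F_t}` generated by `(∑_{i ∈ I} x_i)^{t·D_I + 1}` over nonempty `I`. -/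
noncomputable def forestIdeal (K : Type*) [Field K] {n : ℕ} (t : ℕ)
    (ends : E → Sym2 (Fin n)) : Ideal (MvPolynomial (Fin n) K) :=
  Ideal.span {p | ∃ I : Finset (Fin n), I.Nonempty ∧
    p = (∑ i ∈ I, X i) ^ (t * crossCount ends I + 1)}

/-- The `k`-th graded component of `K[x_1,…,x_n]/J` (for homogeneous `J`):
the image of the degree-`k` homogeneous part in the quotient. -/
noncomputable def gradedPiece (K : Type*) [Field K] {n : ℕ}
    (J : Ideal (MvPolynomial (Fin n) K)) (k : ℕ) :
    Submodule K (MvPolynomial (Fin n) K ⧸ J) :=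
  Submodule.map (Ideal.Quotient.mkₐ K J).toLinearMap
    (homogeneousSubmodule (Fin n) K k)

/-- Dimension of the `k`-th graded component of the quotient. -/
noncomputable def gradedDim (K : Type*) [Field K] {n : ℕ}
    (J : Ideal (MvPolynomial (Fin n) K)) (k : ℕ) : ℕ :=
  Module.finrank K (gradedPiece K J k)


/-- Quotienting in two steps is the same as quotienting at once. -/
def quotQuotEquiv {V : Type*} (r p : V → V → Prop) (q : Quot p → Quot p → Prop)
    (hp : ∀ u v, p u v → Quot.mk r u = Quot.mk r v)
    (hq : ∀ u v, q (Quot.mk p u) (Quot.mk p v) → Quot.mk r u = Quot.mk r v)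
    (hr : ∀ u v, r u v → Quot.mk q (Quot.mk p u) = Quot.mk q (Quot.mk p v)) :
    Quot r ≃ Quot q where
  toFun := Quot.lift (fun u => Quot.mk q (Quot.mk p u)) hr
  invFun := Quot.lift (Quot.lift (Quot.mk r) hp) (by
    rintro ⟨u⟩ ⟨v⟩ h
    exact hq u v h)
  left_inv := by rintro ⟨u⟩; rfl
  right_inv := by rintro ⟨⟨u⟩⟩; rfl

lemma card_quot_glue {W : Type*} [Finite W] {a b : W} (hab : a ≠ b) :
    Nat.card (Quot fun u v : W => u = a ∧ v = b) + 1 = Nat.card W := by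
  classical
  have e : Quot (fun u v : W => u = a ∧ v = b) ≃ {w : W // w ≠ b} :=
    { toFun := Quot.lift (fun w => if h : w = b then ⟨a, hab⟩ else ⟨w, h⟩) (by
        rintro u v ⟨rfl, rfl⟩
        simp [hab])
      invFun := fun w => Quot.mk _ w.1
      left_inv := by
        rintro ⟨w⟩
        by_cases h : w = b
        · subst h
          simpa using Quot.sound ⟨rfl, rfl⟩
        · simp [h]
      right_inv := by
        rintro ⟨w, h⟩
        simp [h] }
  have := Fintype.ofFinite W
  rw [Nat.card_congr e, Nat.card_eq_fintype_card, Nat.card_eq_fintype_card,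
    Fintype.card_subtype_compl, Fintype.card_subtype_eq]
  have : 0 < Fintype.card W := Fintype.card_pos_iff.2 ⟨a⟩
  omega

lemma card_le_card_quot_glue {W : Type*} [Finite W] (a b : W) :
    Nat.card W ≤ Nat.card (Quot fun u v : W => u = a ∧ v = b) + 1 := by
  by_cases hab : a = b
  · subst hab
    refine (Nat.card_le_card_of_injective (Quot.mk fun u v : W => u = a ∧ v = a) ?_).trans
      (Nat.le_succ _)
    intro u v h
    exact congrArg (Quot.lift id (by rintro u v ⟨rfl, rfl⟩; rfl)) h
  · exact (card_quot_glue hab).ge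

section

variable {E' : Type*}

lemma numComponents_congr {ends : E → Sym2 V} {ends' : E' → Sym2 V} {A : Finset E}
    {A' : Finset E'} (h : ∀ z, (∃ e ∈ A, ends e = z) ↔ ∃ e ∈ A', ends' e = z) :
    numComponents ends A = numComponents ends' A' := by
  have : edgeRel ends A = edgeRel ends' A' := by
    funext v w
    exact propext (h _)
  rw [numComponents, numComponents, this]

lemma numComponents_le [Finite V] (ends : E → Sym2 V) (A : Finset E) :
    numComponents ends A ≤ Nat.card V :=
  Nat.card_le_card_of_surjective _ Quot.mk_surjective

lemma numComponents_empty (ends : E → Sym2 V) : numComponents ends ∅ = Nat.card V :=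
  Nat.card_congr
    { toFun := Quot.lift id (by rintro u v ⟨e, he, -⟩; simp at he)
      invFun := Quot.mk _
      left_inv := by rintro ⟨u⟩; rfl
      right_inv := fun _ => rfl }

lemma numComponents_le_insert [Finite V] [DecidableEq E] (ends : E → Sym2 V) (e : E)
    (A : Finset E) : numComponents ends A ≤ numComponents ends (insert e A) + 1 := by
  obtain ⟨a, b, h⟩ : ∃ a b, ends e = s(a, b) :=
    Sym2.ind (f := fun z => ∃ a b, z = s(a, b)) (fun a b => ⟨a, b, rfl⟩) (ends e)
  let p := edgeRel ends A
  have key := card_le_card_quot_glue (Quot.mk p a) (Quot.mk p b)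
  refine key.trans (Nat.add_le_add_right (Nat.card_congr ?_).ge 1)
  refine quotQuotEquiv _ p _ ?_ ?_ ?_
  · rintro u v ⟨f, hf, hfe⟩
    exact Quot.sound ⟨f, Finset.mem_insert_of_mem hf, hfe⟩
  · rintro u v ⟨hu, hv⟩
    have sub : ∀ x y, Quot.mk p x = Quot.mk p y →
        Quot.mk (edgeRel ends (insert e A)) x = Quot.mk (edgeRel ends (insert e A)) y := by
      intro x y hxy
      refine congrArg (Quot.lift (Quot.mk (edgeRel ends (insert e A))) ?_) hxy
      rintro u v ⟨f, hf, hfe⟩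
      exact Quot.sound ⟨f, Finset.mem_insert_of_mem hf, hfe⟩
    rw [sub _ _ hu, sub _ _ hv]
    exact Quot.sound ⟨e, Finset.mem_insert_self _ _, h⟩
  · rintro u v ⟨f, hf, hfe⟩
    rcases Finset.mem_insert.1 hf with rfl | hf
    · rw [h, Sym2.eq_iff] at hfe
      rcases hfe with ⟨rfl, rfl⟩ | ⟨rfl, rfl⟩
      · exact Quot.sound ⟨rfl, rfl⟩
      · exact (Quot.sound ⟨rfl, rfl⟩).symm
    · exact congrArg _ (Quot.sound ⟨f, hf, hfe⟩)

lemma rank_le_card [Finite V] (ends : E → Sym2 V) (A : Finset E) :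
    rank ends A ≤ A.card := by
  classical
  induction A using Finset.induction_on with
  | empty => simp [rank, numComponents_empty]
  | insert e A he ih =>
    rw [Finset.card_insert_of_notMem he]
    have := numComponents_le_insert ends e A
    simp only [rank] at *
    omega

/-- Contracting `s(a, b)` does not change the components of an edge set in which `a` and `b`
are adjacent. -/
lemma numComponents_contract {ends : E → Sym2 V} {ends' : E' → Sym2 V} {A : Finset E}
    {A' : Finset E'} {a b : V}
    (h : ∀ z, (∃ e ∈ A, ends e = z) ↔ z = s(a, b) ∨ ∃ e ∈ A', ends' e = z) :
    numComponents ends A = numComponents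
      (fun e => Sym2.map (Quot.mk fun u v : V => u = a ∧ v = b) (ends' e)) A' := by
  refine Nat.card_congr (quotQuotEquiv _ _ _ ?_ ?_ ?_)
  · rintro u v ⟨rfl, rfl⟩
    exact Quot.sound ((h _).2 (Or.inl rfl))
  · rintro u v ⟨f, hf, hfe⟩
    obtain ⟨c, d, hcd⟩ : ∃ c d, ends' f = s(c, d) :=
      Sym2.ind (f := fun z => ∃ c d, z = s(c, d)) (fun c d => ⟨c, d, rfl⟩) (ends' f)
    have glue : ∀ x y, Quot.mk (fun u v : V => u = a ∧ v = b) x = Quot.mk _ y →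
        Quot.mk (edgeRel ends A) x = Quot.mk (edgeRel ends A) y := by
      intro x y hxy
      refine congrArg (Quot.lift (Quot.mk (edgeRel ends A)) ?_) hxy
      rintro u v ⟨rfl, rfl⟩
      exact Quot.sound ((h _).2 (Or.inl rfl))
    have hq : Quot.mk (edgeRel ends A) c = Quot.mk _ d :=
      Quot.sound ((h _).2 (Or.inr ⟨f, hf, hcd⟩))
    simp only [hcd, Sym2.map_mk, Sym2.eq_iff] at hfe
    rcases hfe with ⟨hc, hd⟩ | ⟨hc, hd⟩
    · rw [← glue _ _ hc, ← glue _ _ hd, hq]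
    · rw [← glue _ _ hc, ← glue _ _ hd, hq]
  · intro u v huv
    rcases (h _).1 huv with huv | ⟨f, hf, hfe⟩
    · rcases Sym2.eq_iff.1 huv with ⟨rfl, rfl⟩ | ⟨rfl, rfl⟩
      · exact congrArg _ (Quot.sound ⟨rfl, rfl⟩)
      · exact congrArg _ (Quot.sound ⟨rfl, rfl⟩).symm
    · exact Quot.sound ⟨f, hf, by simp only [hfe, Sym2.map_mk]⟩

lemma rank_contract [Finite V] {ends : E → Sym2 V} {ends' : E' → Sym2 V} {A : Finset E}
    {A' : Finset E'} {a b : V} (hab : a ≠ b)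
    (h : ∀ z, (∃ e ∈ A, ends e = z) ↔ z = s(a, b) ∨ ∃ e ∈ A', ends' e = z) :
    rank ends A = rank
      (fun e => Sym2.map (Quot.mk fun u v : V => u = a ∧ v = b) (ends' e)) A' + 1 := by
  have h₁ := card_quot_glue hab
  have h₂ := numComponents_le
    (fun e => Sym2.map (Quot.mk fun u v : V => u = a ∧ v = b) (ends' e)) A'
  rw [rank, rank, numComponents_contract h]
  omega

lemma tutte_comp_equiv [Fintype E] [Fintype E'] {R : Type*} [CommRing R] (σ : E ≃ E')
    (ends : E' → Sym2 V) (x y : R) : tutte (ends ∘ σ) x y = tutte ends x y := by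
  have hn : ∀ A : Finset E, rank (ends ∘ σ) A = rank ends (σ.finsetCongr A) := by
    intro A
    rw [rank, rank, numComponents_congr fun z => ?_]
    simp [σ.symm.exists_congr_left]
  have hu : σ.finsetCongr Finset.univ = Finset.univ := by simp
  rw [tutte, tutte, Finset.powerset_univ, Finset.powerset_univ]
  refine Fintype.sum_equiv σ.finsetCongr _ _ fun A => ?_
  rw [hn, hn, hu]
  simp

lemma sum_pow_card_sub_one_nonempty (F : Type*) [Fintype F] {R : Type*} [CommRing R] (y : R) :
    ∑ B : Finset F with B.Nonempty, (y - 1) ^ (B.card - 1) =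
      ∑ i ∈ Finset.range (Fintype.card F), y ^ i := by
  classical
  have h := congrArg (Polynomial.eval (y - 1))
    (Polynomial.geom_sum_X_comp_X_add_one_eq_sum (R := R) (Fintype.card F))
  simp only [Polynomial.eval_comp, Polynomial.eval_finsetSum, Polynomial.eval_pow,
    Polynomial.eval_X, Polynomial.eval_add, Polynomial.eval_one, sub_add_cancel,
    Polynomial.eval_mul, Polynomial.eval_natCast] at h
  rw [h, Finset.sum_filter]
  have := Finset.sum_powerset_apply_card (x := (Finset.univ : Finset F))
    (fun k => if 0 < k then (y - 1) ^ (k - 1) else 0)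
  simp only [Finset.card_pos, Finset.powerset_univ] at this
  rw [this, Finset.card_univ, Finset.sum_range_succ']
  simp

/-- Deletion–contraction for a whole class `F` of parallel edges joining `a` and `b`. -/
lemma tutte_sumElim_parallel [Finite V] [Fintype E] {F : Type*} [Fintype F] {R : Type*}
    [CommRing R] {a b : V} (hab : a ≠ b) (ends : E → Sym2 V)
    (hr : rank (Sum.elim (fun _ : F => s(a, b)) ends) Finset.univ = rank ends Finset.univ)
    (x y : R) :
    tutte (Sum.elim (fun _ : F => s(a, b)) ends) x y =
      (∑ i ∈ Finset.range (Fintype.card F), y ^ i) *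
          tutte (fun e => Sym2.map (Quot.mk fun u v : V => u = a ∧ v = b) (ends e)) x y
        + tutte ends x y := by
  classical
  set g := Sum.elim (fun _ : F => s(a, b)) ends with hg
  set ends' := fun e => Sym2.map (Quot.mk fun u v : V => u = a ∧ v = b) (ends e)
  have hne : ∀ (B : Finset F) (A : Finset E), B.Nonempty →
      rank g (B.disjSum A) = rank ends' A + 1 := by
    intro B A hB
    refine rank_contract hab fun z => ?_
    obtain ⟨i, hi⟩ := hB
    constructor
    · rintro ⟨f | f, hf, rfl⟩
      · exact Or.inl rfl
      · exact Or.inr ⟨f, Finset.inr_mem_disjSum.1 hf, rfl⟩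
    · rintro (rfl | ⟨f, hf, rfl⟩)
      · exact ⟨Sum.inl i, Finset.inl_mem_disjSum.2 hi, rfl⟩
      · exact ⟨Sum.inr f, Finset.inr_mem_disjSum.2 hf, rfl⟩
  have hemp : ∀ A : Finset E, rank g ((∅ : Finset F).disjSum A) = rank ends A := by
    intro A
    rw [rank, rank, numComponents_congr]
    simp [hg]
  rw [← sum_pow_card_sub_one_nonempty, tutte, tutte, tutte]
  simp only [Finset.powerset_univ]
  rw [← Finset.sumEquiv.symm.toEquiv.sum_comp, Fintype.sum_prod_type,
    ← Finset.sum_filter_add_sum_filter_not _ Finset.Nonempty]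
  congr 1
  · rw [Finset.sum_mul]
    refine Finset.sum_congr rfl fun B hB => ?_
    have hB := (Finset.mem_filter.1 hB).2
    rw [Finset.mul_sum]
    refine Finset.sum_congr rfl fun A _ => ?_
    have : Nonempty F := ⟨hB.choose⟩
    have hu := hne Finset.univ Finset.univ Finset.univ_nonempty
    rw [Finset.univ_disjSum_univ] at hu
    have hle := rank_le_card ends' A
    have hpos := hB.card_pos
    have e₁ : (Finset.sumEquiv.symm.toEquiv (B, A) : Finset (F ⊕ E)) = B.disjSum A := rfl
    rw [e₁, hne B A hB, hu, Finset.card_disjSum, Nat.add_sub_add_right,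
      show B.card + A.card - (rank ends' A + 1) = (B.card - 1) + (A.card - rank ends' A) by omega,
      pow_add]
    ring
  · have : (Finset.univ.filter fun B : Finset F => ¬ B.Nonempty) = {∅} := by
      ext B; simp
    rw [this, Finset.sum_singleton]
    refine Finset.sum_congr rfl fun A _ => ?_
    have e₁ : (Finset.sumEquiv.symm.toEquiv (∅, A) : Finset (F ⊕ E)) =
      (∅ : Finset F).disjSum A := rfl
    rw [e₁, hemp, hr, Finset.card_disjSum, Finset.card_empty, zero_add]

/-- Split the `T`-fold copies of the edges into those of `e` and the others. -/
def prodEquivSum [DecidableEq E] (e : E) (T : Type*) : E × T ≃ T ⊕ {f : E // f ≠ e} × T where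
  toFun p := if h : p.1 = e then Sum.inl p.2 else Sum.inr (⟨p.1, h⟩, p.2)
  invFun := Sum.elim (fun i => (e, i)) fun p => (p.1.1, p.2)
  left_inv := by
    rintro ⟨f, i⟩
    by_cases h : f = e <;> simp [h]
  right_inv := by
    rintro (i | ⟨⟨f, h⟩, i⟩)
    · simp
    · simp [h]

end

/-- Let `G` be a finite multigraph, `t ≥ 1`, and `e` an edge
of `G` with distinct endpoints `a, b` that is neither a loop nor a bridge
(deleting `e` does not change the number of connected components). Then
`T_Ĝ(x,y) = (y^{t-1} + … + y + 1)·T_{\widehat{G·e}}(x,y) + T_{\widehat{G-e}}(x,y)`,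
where `Ĥ` replaces every edge of `H` by `t` parallel copies, `G - e` deletes
`e`, and `G·e` contracts `e` (its endpoints are identified via the quotient of
the vertex set identifying `a` and `b`). -/
theorem tutte_hat_ordinary {U E : Type} [Finite U] [Fintype E] [DecidableEq E]
    {R : Type} [CommRing R] (t : ℕ) (ht : 1 ≤ t) (ends : E → Sym2 U)
    (e : E) (a b : U) (hab : a ≠ b) (he : ends e = s(a, b))
    (hnotbridge : numComponents ends (Finset.univ.erase e)
      = numComponents ends Finset.univ) (x y : R) :
    tutte (V := U) (fun p : E × Fin t => ends p.1) x y
      = (∑ i ∈ Finset.range t, y ^ i) *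
          tutte (V := Quot fun u v : U => u = a ∧ v = b)
            (fun p : {f : E // f ≠ e} × Fin t =>
              Sym2.map (Quot.mk fun u v : U => u = a ∧ v = b) (ends p.1.1)) x y
        + tutte (V := U) (fun p : {f : E // f ≠ e} × Fin t => ends p.1.1) x y := by
  have : Nonempty (Fin t) := ⟨⟨0, ht⟩⟩
  have hsplit : (fun p : E × Fin t => ends p.1) =
      Sum.elim (fun _ : Fin t => s(a, b))
        (fun p : {f : E // f ≠ e} × Fin t => ends p.1.1) ∘ prodEquivSum e (Fin t) := by
    funext ⟨f, i⟩
    by_cases h : f = e <;> simp [prodEquivSum, h, he]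
  rw [hsplit, tutte_comp_equiv, tutte_sumElim_parallel hab, Fintype.card_fin]
  have hfull : numComponents (Sum.elim (fun _ : Fin t => s(a, b))
      (fun p : {f : E // f ≠ e} × Fin t => ends p.1.1)) Finset.univ =
      numComponents ends Finset.univ := by
    refine numComponents_congr fun z => ?_
    constructor
    · rintro ⟨i | ⟨f, i⟩, -, rfl⟩
      · exact ⟨e, Finset.mem_univ _, he⟩
      · exact ⟨f, Finset.mem_univ _, rfl⟩
    · rintro ⟨f, -, rfl⟩
      by_cases h : f = e
      · exact ⟨Sum.inl ⟨0, ht⟩, Finset.mem_univ _, by rw [h, he]; rfl⟩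
      · exact ⟨Sum.inr (⟨f, h⟩, ⟨0, ht⟩), Finset.mem_univ _, rfl⟩
  have hdel : numComponents (fun p : {f : E // f ≠ e} × Fin t => ends p.1.1) Finset.univ =
      numComponents ends (Finset.univ.erase e) := by
    refine numComponents_congr fun z => ?_
    simp
  rw [rank, rank, hfull, hdel, hnotbridge]

end ForestAlg
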